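/- On pairs ⟨n, f⟩ with f ∈ 𝓡(n) non-degenerate, define the relation Rel(⟨m, f⟩, ⟨n, g⟩) :⇔ there exists a map φ : Fin m → Fin n with φ_*f = g. Then two non-degenerate pairs ⟨m, f⟩ and ⟨n, g⟩ are related by the equivalence relation generated by Rel (EqvGen Rel) if and only if f and g have the same type. Consequently, the special polynomials form a complete set of representatives of the connected components of the category of non-degenerate objects and effective morphisms. -/

import Mathlib

open MvPolynomial

/-- `f ∈ 𝓡(n)`: `f` is a sum of distinct monic squarefree monomials of positive
degree: all coefficients of monomials in the support are `1`, all exponents are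
`≤ 1`, and the constant coefficient vanishes. -/
def IsRPoly {n : ℕ} (f : MvPolynomial (Fin n) ℤ) : Prop :=
  (∀ d ∈ f.support, f.coeff d = 1) ∧
  (∀ d ∈ f.support, ∀ i, d i ≤ 1) ∧
  f.coeff 0 = 0

/-- `f` is non-degenerate if every variable occurs in `f`,
i.e. `∂f/∂a_s ≠ 0` for all `s`. -/
def NonDegen {n : ℕ} (f : MvPolynomial (Fin n) ℤ) : Prop :=
  ∀ s : Fin n, MvPolynomial.pderiv s f ≠ 0

/-- The type of `f`: the multiset of total degrees of the monomials in the
support of `f`. -/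
def polyType {n : ℕ} (f : MvPolynomial (Fin n) ℤ) : Multiset ℕ :=
  f.support.val.map fun I => I.sum fun _ e => e

/-- The `j`-th block `B_j = {k₁+⋯+k_{j-1}+1, …, k₁+⋯+k_j}` of indices in
`Fin n`, for block sizes `k : Fin l → ℕ`. -/
def specialBlock {n l : ℕ} (k : Fin l → ℕ) (j : Fin l) : Finset (Fin n) :=
  Finset.univ.filter fun i : Fin n =>
    (∑ t ∈ Finset.univ.filter (fun t => t < j), k t) ≤ i.1 ∧
    i.1 < (∑ t ∈ Finset.univ.filter (fun t => t < j), k t) + k j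

/-- `f ∈ 𝓡(n)` is special if
`f = a₁⋯a_{k₁} + ⋯ + a_{k₁+⋯+k_{l-1}+1}⋯a_n`
for some `0 < k₁ ≤ ⋯ ≤ k_l` with `Σ kᵢ = n`. -/
def IsSpecial {n : ℕ} (f : MvPolynomial (Fin n) ℤ) : Prop :=
  ∃ (l : ℕ) (k : Fin l → ℕ), (∀ i, 0 < k i) ∧ Monotone k ∧ (∑ i, k i) = n ∧
    f = ∑ j : Fin l, ∏ i ∈ specialBlock k j, MvPolynomial.X i

/-- Pairs `⟨n, f⟩` with `f ∈ 𝓡(n)` non-degenerate (the objects of the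
non-degenerate effective subcategory). -/
def NDPair : Type :=
  Σ n : ℕ, {f : MvPolynomial (Fin n) ℤ // IsRPoly f ∧ NonDegen f}

/-- The relation: there is a (necessarily effective) morphism from `⟨m, f⟩` to
`⟨n, g⟩`, i.e. a map `φ` with `φ_* f = g`. -/
def NDRel (x y : NDPair) : Prop :=
  ∃ φ : Fin x.1 → Fin y.1, MvPolynomial.rename φ x.2.val = y.2.val

/-- The coefficients of a sum of distinct monic monomials. -/
theorem coeff_sum_monomial_one {σ : Type*} [DecidableEq σ] (s : Finset (σ →₀ ℕ)) (e : σ →₀ ℕ) :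
    coeff e (∑ d ∈ s, monomial d (1 : ℤ)) = if e ∈ s then 1 else 0 := by
  simp [coeff_sum, coeff_monomial]

theorem support_sum_monomial_one {σ : Type*} [DecidableEq σ] (s : Finset (σ →₀ ℕ)) :
    (∑ d ∈ s, monomial d (1 : ℤ)).support = s := by
  ext e
  rw [mem_support_iff, coeff_sum_monomial_one]
  simp

theorem IsRPoly.eq_sum_monomial {n : ℕ} {f : MvPolynomial (Fin n) ℤ} (hf : IsRPoly f) :
    f = ∑ d ∈ f.support, monomial d 1 := by
  conv_lhs => rw [f.as_sum]
  exact Finset.sum_congr rfl fun d hd => by rw [hf.1 d hd]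

theorem polyType_eq_map_degree {n : ℕ} (f : MvPolynomial (Fin n) ℤ) :
    polyType f = f.support.val.map Finsupp.degree := rfl

/-- A substitution of variables between elements of `𝓡` preserves the type: no two monomials
can be identified, since this would create a coefficient greater than `1`. -/
theorem IsRPoly.polyType_rename {m n : ℕ} {f : MvPolynomial (Fin m) ℤ} (hf : IsRPoly f)
    (φ : Fin m → Fin n) (hg : IsRPoly (rename φ f)) : polyType (rename φ f) = polyType f := by
  have hren : rename φ f = ∑ d ∈ f.support, monomial (d.mapDomain φ) 1 := by
    conv_lhs => rw [hf.eq_sum_monomial]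
    simp [map_sum, rename_monomial]
  have hcoeff : ∀ e, coeff e (rename φ f) =
      ((f.support.filter fun d => d.mapDomain φ = e).card : ℤ) := by
    intro e
    rw [hren]
    simp [coeff_sum, coeff_monomial]
  have hinj : Set.InjOn (Finsupp.mapDomain φ) (f.support : Set (Fin m →₀ ℕ)) := by
    intro d hd d' hd' h
    have hle : coeff (d'.mapDomain φ) (rename φ f) ≤ 1 := by
      by_cases hs : d'.mapDomain φ ∈ (rename φ f).support
      · exact (hg.1 _ hs).le
      · rw [notMem_support_iff.1 hs]; exact zero_le_one
    rw [hcoeff] at hle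
    have hcard : (f.support.filter fun c => c.mapDomain φ = d'.mapDomain φ).card ≤ 1 := by
      exact_mod_cast hle
    exact Finset.card_le_one.1 hcard d (Finset.mem_filter.2 ⟨hd, h⟩) d'
      (Finset.mem_filter.2 ⟨hd', rfl⟩)
  have hsupp : (rename φ f).support = f.support.image (Finsupp.mapDomain φ) := by
    rw [hren, ← Finset.sum_image (f := fun e => monomial e (1 : ℤ)) hinj,
      support_sum_monomial_one]
  rw [polyType_eq_map_degree, polyType_eq_map_degree, hsupp, Finset.image_val_of_injOn hinj,
    Multiset.map_map]
  exact Multiset.map_congr rfl fun d _ => Finsupp.degree_mapDomain φ d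

/-- A variable that occurs in some monomial has nonzero partial derivative. -/
theorem pderiv_ne_zero_of_mem_support {σ : Type*} {f : MvPolynomial σ ℤ} {d : σ →₀ ℕ} {s : σ}
    (hd : d ∈ f.support) (hs : d s ≠ 0) : pderiv s f ≠ 0 := by
  intro h
  have hc := coeff_pderiv (i := s) f (d - Finsupp.single s 1)
  have hle : Finsupp.single s 1 ≤ d := by
    rw [Finsupp.single_le_iff]; omega
  rw [h, tsub_add_cancel_of_le hle, coeff_zero] at hc
  rcases mul_eq_zero.1 hc.symm with h0 | h0
  · exact mem_support_iff.1 hd h0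
  · exact Nat.cast_add_one_ne_zero _ h0

/-- The exponent vector of the squarefree monomial `∏ i ∈ s, a_i`. -/
noncomputable def squarefreeExp {σ : Type*} (s : Finset σ) : σ →₀ ℕ :=
  ∑ i ∈ s, Finsupp.single i 1

theorem monomial_squarefreeExp {σ : Type*} (s : Finset σ) :
    monomial (squarefreeExp s) (1 : ℤ) = ∏ i ∈ s, X i :=
  monomial_sum_one s _

theorem squarefreeExp_apply {σ : Type*} [DecidableEq σ] (s : Finset σ) (i : σ) :
    squarefreeExp s i = if i ∈ s then 1 else 0 := by
  simp [squarefreeExp, Finsupp.finsetSum_apply, Finsupp.single_apply]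

theorem degree_squarefreeExp {σ : Type*} (s : Finset σ) :
    (squarefreeExp s).degree = s.card := by
  simp [squarefreeExp, map_sum]

theorem squarefreeExp_support {σ : Type*} {d : σ →₀ ℕ} (hd : ∀ i, d i ≤ 1) :
    squarefreeExp d.support = d := by
  classical
  ext i
  rw [squarefreeExp_apply]
  have := hd i
  split_ifs with h <;> simp at h <;> omega

theorem squarefreeExp_injective {σ : Type*} :
    Function.Injective (squarefreeExp : Finset σ → σ →₀ ℕ) := by
  classical
  intro s t h
  ext i
  have := DFunLike.congr_fun h i
  rw [squarefreeExp_apply, squarefreeExp_apply] at this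
  split_ifs at this <;> simp_all

theorem val_finSigmaFinEquiv {l : ℕ} {k : Fin l → ℕ} (p : (j : Fin l) × Fin (k j)) :
    (finSigmaFinEquiv p : ℕ) = (∑ t ∈ Finset.univ.filter (fun t => t < p.1), k t) + p.2 := by
  rw [finSigmaFinEquiv_apply]
  congr 1
  refine Finset.sum_bij (fun i _ => Fin.castLE p.1.2.le i) ?_ ?_ ?_ ?_
  · intro i _
    exact Finset.mem_filter.2 ⟨Finset.mem_univ _, i.2⟩
  · intro a _ b _ h
    simpa using h
  · intro b hb
    simp only [Finset.mem_filter, Finset.mem_univ, true_and] at hb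
    exact ⟨⟨b, hb⟩, Finset.mem_univ _, rfl⟩
  · intro i _
    rfl

theorem sum_filter_lt_add_le {l : ℕ} (k : Fin l → ℕ) {i j : Fin l} (h : i < j) :
    (∑ t ∈ Finset.univ.filter (fun t => t < i), k t) + k i ≤
      ∑ t ∈ Finset.univ.filter (fun t => t < j), k t := by
  rw [add_comm, ← Finset.sum_insert (by simp)]
  refine Finset.sum_le_sum_of_subset fun t ht => ?_
  simp only [Finset.mem_insert, Finset.mem_filter, Finset.mem_univ, true_and] at ht ⊢
  rcases ht with rfl | ht
  · exact h
  · exact ht.trans h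

theorem finSigmaFinEquiv_mem_specialBlock {l : ℕ} {k : Fin l → ℕ} (p : (j : Fin l) × Fin (k j))
    (j : Fin l) : finSigmaFinEquiv p ∈ specialBlock k j ↔ p.1 = j := by
  have hp := p.2.2
  simp only [specialBlock, Finset.mem_filter, Finset.mem_univ, true_and, val_finSigmaFinEquiv]
  constructor
  · rintro ⟨h1, h2⟩
    rcases lt_trichotomy p.1 j with h | h | h
    · have := sum_filter_lt_add_le k h
      omega
    · exact h
    · have := sum_filter_lt_add_le k h
      omega
  · rintro rfl
    omega

theorem specialBlock_eq_map {l : ℕ} (k : Fin l → ℕ) (j : Fin l) :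
    (specialBlock k j : Finset (Fin (∑ i, k i))) =
      Finset.univ.map ((Function.Embedding.sigmaMk j).trans finSigmaFinEquiv.toEmbedding) := by
  ext i
  obtain ⟨p, rfl⟩ := finSigmaFinEquiv.surjective i
  rw [finSigmaFinEquiv_mem_specialBlock]
  obtain ⟨j', t⟩ := p
  simp only [Finset.mem_map, Finset.mem_univ, true_and, Function.Embedding.trans_apply,
    Equiv.coe_toEmbedding, EmbeddingLike.apply_eq_iff_eq, Function.Embedding.sigmaMk_apply]
  constructor
  · rintro rfl
    exact ⟨t, rfl⟩
  · rintro ⟨a, h⟩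
    exact (congrArg Sigma.fst h).symm

/-- The special polynomial with block sizes `k`. -/
noncomputable def specialPoly {l : ℕ} (k : Fin l → ℕ) : MvPolynomial (Fin (∑ i, k i)) ℤ :=
  ∑ j, ∏ i ∈ specialBlock k j, X i

theorem card_specialBlock {l : ℕ} (k : Fin l → ℕ) (j : Fin l) :
    (specialBlock k j : Finset (Fin (∑ i, k i))).card = k j := by
  simp [specialBlock_eq_map]

theorem specialBlock_injective {l : ℕ} {k : Fin l → ℕ} (hk : ∀ i, 0 < k i) :
    Function.Injective (specialBlock k : Fin l → Finset (Fin (∑ i, k i))) := by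
  intro j j' h
  have := (finSigmaFinEquiv_mem_specialBlock ⟨j, ⟨0, hk j⟩⟩ j).2 rfl
  rw [h, finSigmaFinEquiv_mem_specialBlock] at this
  exact this

theorem support_specialPoly {l : ℕ} {k : Fin l → ℕ} (hk : ∀ i, 0 < k i) :
    (specialPoly k).support = Finset.univ.map
      ⟨fun j => squarefreeExp (specialBlock k j),
        squarefreeExp_injective.comp (specialBlock_injective hk)⟩ := by
  rw [← support_sum_monomial_one (Finset.map _ _), Finset.sum_map]
  simp [specialPoly, monomial_squarefreeExp]

theorem polyType_specialPoly {l : ℕ} {k : Fin l → ℕ} (hk : ∀ i, 0 < k i) :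
    polyType (specialPoly k) = (List.ofFn k : Multiset ℕ) := by
  rw [polyType_eq_map_degree, support_specialPoly hk, Finset.map_val, Multiset.map_map,
    List.ofFn_eq_map]
  simp only [Function.comp_def, Function.Embedding.coeFn_mk, degree_squarefreeExp,
    card_specialBlock]
  rfl

theorem isRPoly_specialPoly {l : ℕ} {k : Fin l → ℕ} (hk : ∀ i, 0 < k i) :
    IsRPoly (specialPoly k) := by
  have hsum : specialPoly k = ∑ d ∈ (specialPoly k).support, monomial d 1 := by
    rw [support_specialPoly hk, Finset.sum_map]
    simp [specialPoly, monomial_squarefreeExp]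
  refine ⟨fun d hd => ?_, fun d hd i => ?_, ?_⟩
  · rw [hsum, coeff_sum_monomial_one, if_pos hd]
  · rw [support_specialPoly hk] at hd
    obtain ⟨j, -, rfl⟩ := Finset.mem_map.1 hd
    simp only [Function.Embedding.coeFn_mk, squarefreeExp_apply]
    split_ifs <;> simp
  · rw [← notMem_support_iff, support_specialPoly hk]
    intro h
    obtain ⟨j, -, h⟩ := Finset.mem_map.1 h
    have := congrArg Finsupp.degree h
    simp only [Function.Embedding.coeFn_mk, degree_squarefreeExp, card_specialBlock,
      map_zero] at this
    exact (hk j).ne' this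

theorem nonDegen_specialPoly {l : ℕ} {k : Fin l → ℕ} (hk : ∀ i, 0 < k i) :
    NonDegen (specialPoly k) := by
  intro s
  obtain ⟨p, rfl⟩ := finSigmaFinEquiv.surjective s
  refine pderiv_ne_zero_of_mem_support (d := squarefreeExp (specialBlock k p.1)) ?_ ?_
  · rw [support_specialPoly hk]
    exact Finset.mem_map.2 ⟨p.1, Finset.mem_univ _, rfl⟩
  · rw [squarefreeExp_apply, if_pos ((finSigmaFinEquiv_mem_specialBlock p p.1).2 rfl)]
    exact one_ne_zero

/-- The special polynomial with block sizes `k`, as an object of the non-degenerate category. -/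
noncomputable def specialPair {l : ℕ} (k : Fin l → ℕ) (hk : ∀ i, 0 < k i) : NDPair :=
  ⟨∑ i, k i, specialPoly k, isRPoly_specialPoly hk, nonDegen_specialPoly hk⟩

theorem isSpecial_specialPair {l : ℕ} {k : Fin l → ℕ} (hk : ∀ i, 0 < k i) (hmono : Monotone k) :
    IsSpecial (specialPair k hk).2.val :=
  ⟨l, k, hk, hmono, rfl, rfl⟩

theorem IsSpecial.exists_eq_specialPair {x : NDPair} (hx : IsSpecial x.2.val) :
    ∃ (l : ℕ) (k : Fin l → ℕ) (hk : ∀ i, 0 < k i), Monotone k ∧ x = specialPair k hk := by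
  obtain ⟨n, f, hf⟩ := x
  obtain ⟨l, k, hk, hmono, hn, h⟩ := hx
  refine ⟨l, k, hk, hmono, ?_⟩
  dsimp only at hn
  subst hn
  exact congrArg (Sigma.mk _) (Subtype.ext h)

/-- A special object with blocks of nondecreasing size is determined by its type. -/
theorem specialPair_eq_of_polyType_eq {l l' : ℕ} {k : Fin l → ℕ} {k' : Fin l' → ℕ}
    {hk : ∀ i, 0 < k i} {hk' : ∀ i, 0 < k' i} (hmono : Monotone k) (hmono' : Monotone k')
    (h : polyType (specialPair k hk).2.val = polyType (specialPair k' hk').2.val) :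
    specialPair k hk = specialPair k' hk' := by
  have hperm : (List.ofFn k).Perm (List.ofFn k') :=
    Multiset.coe_eq_coe.1 ((polyType_specialPoly hk).symm.trans (h.trans (polyType_specialPoly hk')))
  have := hperm.eq_of_sortedLE hmono.sortedLE_ofFn hmono'.sortedLE_ofFn
  have hsig := List.ofFn_inj'.1 this
  cases hsig
  rfl

/-- Every non-degenerate object receives a morphism from a special one: enumerate the monomials
by nondecreasing degree and match the blocks with their sets of variables. -/
theorem exists_specialPair_ndRel (x : NDPair) :
    ∃ (l : ℕ) (k : Fin l → ℕ) (hk : ∀ i, 0 < k i), Monotone k ∧ NDRel (specialPair k hk) x := by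
  obtain ⟨n, f, hf, hnd⟩ := x
  let e₀ : Fin f.support.card ≃ f.support := f.support.equivFin.symm
  let c : Fin f.support.card → ℕ := fun j => (e₀ j).1.support.card
  let e : Fin f.support.card ≃ f.support := (Tuple.sort c).trans e₀
  let k : Fin f.support.card → ℕ := fun j => (e j).1.support.card
  have hmono : Monotone k := Tuple.monotone_sort c
  have hk : ∀ j, 0 < k j := by
    intro j
    rw [Finset.card_pos, Finsupp.support_nonempty_iff]
    intro h0
    have := mem_support_iff.1 (e j).2
    rw [h0] at this
    exact this hf.2.2
  let ψ : (j : Fin f.support.card) × Fin (k j) → Fin n :=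
    fun p => ((e p.1).1.support.equivFin.symm p.2).1
  let φ : Fin (∑ i, k i) → Fin n := fun i => ψ (finSigmaFinEquiv.symm i)
  refine ⟨_, k, hk, hmono, φ, ?_⟩
  change rename φ (specialPoly k) = f
  conv_rhs => rw [hf.eq_sum_monomial, ← Finset.sum_coe_sort, ← Equiv.sum_comp e]
  rw [specialPoly, map_sum]
  refine Finset.sum_congr rfl fun j _ => ?_
  rw [map_prod, specialBlock_eq_map, Finset.prod_map]
  conv_rhs => rw [← squarefreeExp_support (hf.2.1 _ (e j).2), monomial_squarefreeExp,
    ← Finset.prod_coe_sort, ← Equiv.prod_comp (e j).1.support.equivFin.symm]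
  refine Finset.prod_congr rfl fun t _ => ?_
  simp only [Function.Embedding.trans_apply, Equiv.coe_toEmbedding,
    Function.Embedding.sigmaMk_apply, rename_X, φ, Equiv.symm_apply_apply]
  rfl

theorem NDRel.polyType_eq {x y : NDPair} (h : NDRel x y) :
    polyType x.2.val = polyType y.2.val := by
  obtain ⟨φ, hφ⟩ := h
  have hy := y.2.2.1
  rw [← hφ] at hy ⊢
  exact (x.2.2.1.polyType_rename φ hy).symm

theorem polyType_eq_of_eqvGen {x y : NDPair} (h : Relation.EqvGen NDRel x y) :
    polyType x.2.val = polyType y.2.val := by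
  induction h with
  | rel _ _ h => exact h.polyType_eq
  | refl _ => rfl
  | symm _ _ _ ih => exact ih.symm
  | trans _ _ _ _ _ ih₁ ih₂ => exact ih₁.trans ih₂

/-- Two non-degenerate pairs are connected (related by the equivalence relation
generated by `NDRel`) iff they have the same type.  Consequently, the special
polynomials form a complete set of representatives of the connected components
of the category of non-degenerate objects and effective morphisms. -/
theorem ndrel_eqvGen_iff_same_type :
    (∀ x y : NDPair, Relation.EqvGen NDRel x y ↔ polyType x.2.val = polyType y.2.val) ∧
    (∀ x : NDPair, ∃ y : NDPair, IsSpecial y.2.val ∧ Relation.EqvGen NDRel x y ∧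
      ∀ y' : NDPair, IsSpecial y'.2.val → Relation.EqvGen NDRel x y' → y' = y) := by
  refine ⟨fun x y => ⟨polyType_eq_of_eqvGen, fun h => ?_⟩, fun x => ?_⟩
  · obtain ⟨l, k, hk, hmono, hx⟩ := exists_specialPair_ndRel x
    obtain ⟨l', k', hk', hmono', hy⟩ := exists_specialPair_ndRel y
    have heq := specialPair_eq_of_polyType_eq hmono hmono'
      (hx.polyType_eq.trans (h.trans hy.polyType_eq.symm))
    rw [← heq] at hy
    exact .trans _ _ _ (.symm _ _ (.rel _ _ hx)) (.rel _ _ hy)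
  · obtain ⟨l, k, hk, hmono, hx⟩ := exists_specialPair_ndRel x
    refine ⟨specialPair k hk, isSpecial_specialPair hk hmono, .symm _ _ (.rel _ _ hx), ?_⟩
    intro y' hy' hxy'
    obtain ⟨l', k', hk', hmono', rfl⟩ := hy'.exists_eq_specialPair
    exact specialPair_eq_of_polyType_eq hmono' hmono
      ((polyType_eq_of_eqvGen hxy').symm.trans hx.polyType_eq.symm)
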